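/- arXiv:1603.06427 — 9 statements merged into one kernel-verified Lean document; each statement's English description precedes it below -/
import Mathlib

section
/- Let k be an algebraically closed field, let ν ≥ 1, and let G be a finite subgroup of the group (kˣ)^ν of ν-tuples of nonzero elements of k under componentwise multiplication. For a ∈ ℤ^ν let ρ_a : G → kˣ denote the character defined by ρ_a(g) = ∏_{i=1}^{ν} g_i^{a_i}. Let χ : G → kˣ be any group homomorphism. Then the limit as N → ∞ of the quotient (card {a ∈ ℕ^ν : a_1 + ⋯ + a_ν ≤ N and ρ_a = χ}) / (card {a ∈ ℕ^ν : a_1 + ⋯ + a_ν ≤ N}) exists and equals 1 / card(G). -/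
open Filter Topology in
theorem aux_ratio (D : ℕ → ℕ) (ν : ℕ) (hD : ∀ N, D N = (ν + N).choose N) (m : ℕ) :
    Tendsto (fun N : ℕ => (D (N + m) : ℝ) / D N) atTop (𝓝 1) := by
  have hpos : ∀ N, (0 : ℝ) < D N := by
    intro N
    rw [hD]
    exact_mod_cast Nat.choose_pos (by omega)
  have h1 : Tendsto (fun N : ℕ => (D (N + 1) : ℝ) / D N) atTop (𝓝 1) := by
    have : (fun N : ℕ => (D (N + 1) : ℝ) / D N) = fun N : ℕ => 1 + (ν : ℝ) / ((N : ℝ) + 1) := by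
      funext N
      have h := Nat.add_one_mul_choose_eq (ν + N) N
      have h2 : ((ν : ℝ) + N + 1) * D N = D (N + 1) * (N + 1) := by
        rw [hD, hD]
        exact_mod_cast h
      have := hpos N
      have hN : (0 : ℝ) < (N : ℝ) + 1 := by positivity
      field_simp
      linarith
    rw [this]
    have h3 : Tendsto (fun N : ℕ => (ν : ℝ) / ((N : ℝ) + 1)) atTop (𝓝 0) :=
      tendsto_const_nhds.div_atTop
        (tendsto_atTop_add_const_right _ _ tendsto_natCast_atTop_atTop)
    simpa using h3.const_add 1
  induction m with
  | zero =>
    have : (fun N : ℕ => (D (N + 0) : ℝ) / D N) = fun _ => 1 := by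
      funext N
      exact div_self (hpos N).ne'
    rw [this]
    exact tendsto_const_nhds
  | succ m ih =>
    have h4 := (h1.comp (tendsto_add_atTop_nat m)).mul ih
    rw [one_mul] at h4
    refine h4.congr fun N => ?_
    have := (hpos N).ne'
    have := (hpos (N + m)).ne'
    simp only [Function.comp]
    rw [← add_assoc]
    field_simp

theorem aux_finite (ν N : ℕ) : {a : Fin ν → ℕ | (∑ i, a i) ≤ N}.Finite := by
  refine (Set.finite_Iic (fun _ : Fin ν => N)).subset ?_
  intro a ha i
  exact (Finset.single_le_sum (fun _ _ => Nat.zero_le _) (Finset.mem_univ i)).trans ha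

theorem aux_card (ν N : ℕ) :
    Nat.card {a : Fin ν → ℕ | (∑ i, a i) ≤ N} = (ν + N).choose N := by
  have e : {a : Fin ν → ℕ | (∑ i, a i) ≤ N} ≃ {P : Fin (ν + 1) → ℕ // ∑ i, P i = N} :=
    { toFun := fun a => ⟨Fin.cons (N - ∑ i, a.1 i) a.1, by
        have := a.2
        simp only [Set.mem_ofPred_eq] at this
        simp [Fin.sum_univ_succ]
        omega⟩
      invFun := fun P => ⟨Fin.tail P.1, by
        have := P.2
        rw [Fin.sum_univ_succ] at this
        simp only [Set.mem_ofPred_eq, Fin.tail]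
        omega⟩
      left_inv := fun a => by simp
      right_inv := fun P => by
        obtain ⟨P, hP⟩ := P
        ext i
        rw [Fin.sum_univ_succ] at hP
        refine Fin.cases ?_ (fun j => ?_) i
        · simp [Fin.tail]
          omega
        · simp [Fin.tail] }
  rw [Nat.card_congr (e.trans (Sym.equivNatSumOfFintype (Fin (ν + 1)) N).symm),
    Nat.card_eq_fintype_card, Sym.card_sym_eq_choose]
  congr 1
  simp

theorem aux_li {k A : Type*} [Field k] [Monoid A] :
    LinearIndependent k (fun f : A →* kˣ => (fun a => ((f a : kˣ) : k) : A → k)) := by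
  have h := linearIndependent_monoidHom A k
  refine h.comp (fun f : A →* kˣ => (Units.coeHom k).comp f) ?_
  intro f g hfg
  ext a
  exact DFunLike.congr_fun hfg a

theorem aux_dual_finite {k A : Type*} [Field k] [Monoid A] [Finite A] :
    Finite (A →* kˣ) := (aux_li (k := k) (A := A)).finite

theorem aux_dual_card {k A : Type*} [Field k] [Monoid A] [Finite A] :
    Nat.card (A →* kˣ) ≤ Nat.card A := by
  have := aux_dual_finite (k := k) (A := A)
  have := Fintype.ofFinite A
  have := Fintype.ofFinite (A →* kˣ)
  rw [Nat.card_eq_fintype_card, Nat.card_eq_fintype_card]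
  simpa using (aux_li (k := k) (A := A)).fintype_card_le_finrank

/-- The character `ρ_a`, as a monoid homomorphism in `a`. -/
def auxRho {k : Type*} [Field k] {ν : ℕ} (G : Subgroup (Fin ν → kˣ)) :
    Multiplicative (Fin ν → ℕ) →* (G →* kˣ) where
  toFun a :=
    { toFun := fun g => ∏ i, (g : Fin ν → kˣ) i ^ (a.toAdd i)
      map_one' := by simp
      map_mul' := by intro g h; simp [mul_pow, Finset.prod_mul_distrib] }
  map_one' := by ext; simp
  map_mul' a b := by ext; simp [pow_add, Finset.prod_mul_distrib]

theorem aux_surj {k : Type*} [Field k] {ν : ℕ} (G : Subgroup (Fin ν → kˣ)) [Finite G] :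
    Function.Surjective (auxRho G) ∧ Nat.card (G →* kˣ) = Nat.card G := by
  have hf := aux_dual_finite (k := k) (A := G)
  have h1 := aux_dual_card (k := k) (A := G)
  set H := MonoidHom.mrange (auxRho G) with hH
  have h2 := aux_dual_card (k := k) (A := H)
  have hf2 := aux_dual_finite (k := k) (A := H)
  have h3 : Nat.card G ≤ Nat.card (H →* kˣ) := by
    let ev : G → (H →* kˣ) := fun g =>
      { toFun := fun c => c.1 g
        map_one' := by simp
        map_mul' := by intro c d; simp }
    refine Nat.card_le_card_of_injective ev ?_
    intro g h hgh
    ext i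
    have h5 := DFunLike.congr_fun hgh
      ⟨auxRho G (Multiplicative.ofAdd (Pi.single i 1)), ⟨_, rfl⟩⟩
    have h6 : ∀ g : G, auxRho G (Multiplicative.ofAdd (Pi.single i 1)) g = g.1 i := by
      intro g
      simp only [auxRho, MonoidHom.coe_mk, OneHom.coe_mk, toAdd_ofAdd]
      rw [Finset.prod_eq_single i]
      · simp
      · intro j _ hj
        simp [hj]
      · simp
    have h7 : auxRho G (Multiplicative.ofAdd (Pi.single i 1)) g =
      auxRho G (Multiplicative.ofAdd (Pi.single i 1)) h := h5
    rw [h6, h6] at h7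
    rw [h7]
  have h4 : Nat.card H ≤ Nat.card (G →* kˣ) :=
    Nat.card_le_card_of_injective _ Subtype.val_injective
  refine ⟨?_, by omega⟩
  have h8 : Function.Bijective (Subtype.val : H → (G →* kˣ)) := by
    rw [Nat.bijective_iff_injective_and_card]
    exact ⟨Subtype.val_injective, by omega⟩
  intro c
  obtain ⟨⟨_, a, rfl⟩, rfl⟩ := h8.2 c
  exact ⟨a, rfl⟩

/-- Abstract equidistribution. -/
theorem aux_equi {ν : ℕ} {C : Type*} [CommGroup C] [Finite C]
    (ρ : Multiplicative (Fin ν → ℕ) →* C) (hρ : Function.Surjective ρ) :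
    ∃ m : ℕ, ∀ N : ℕ, ∀ c : C,
      |(Nat.card C : ℝ) * Nat.card {a : Fin ν → ℕ | (∑ i, a i) ≤ N ∧ ρ (.ofAdd a) = c}
        - Nat.card {a : Fin ν → ℕ | (∑ i, a i) ≤ N}| ≤
      Nat.card C * ((Nat.card {a : Fin ν → ℕ | (∑ i, a i) ≤ N + m} : ℝ)
        - Nat.card {a : Fin ν → ℕ | (∑ i, a i) ≤ N}) := by
  classical
  have := Fintype.ofFinite C
  let S : ℕ → Finset (Fin ν → ℕ) := fun N => (aux_finite ν N).toFinset
  have hS : ∀ N a, a ∈ S N ↔ ∑ i, a i ≤ N := fun N a => by simp [S]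
  have hD : ∀ N, Nat.card {a : Fin ν → ℕ | (∑ i, a i) ≤ N} = (S N).card := by
    intro N
    exact Nat.subtype_card _ (hS N)
  let A : ℕ → C → Finset (Fin ν → ℕ) := fun N c => (S N).filter fun a => ρ (.ofAdd a) = c
  have hA : ∀ N c, Nat.card {a : Fin ν → ℕ | (∑ i, a i) ≤ N ∧ ρ (.ofAdd a) = c}
      = (A N c).card := by
    intro N c
    exact Nat.subtype_card _ (by simp [A, hS])
  have hsum : ∀ N, (S N).card = ∑ c, (A N c).card := fun N =>
    Finset.card_eq_sum_card_fiberwise (fun _ _ => Finset.mem_univ _)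
  have hmono : ∀ M N, M ≤ N → ∀ c, (A M c).card ≤ (A N c).card := by
    intro M N h c
    refine Finset.card_le_card fun a ha => ?_
    simp only [A, Finset.mem_filter, hS] at ha ⊢
    exact ⟨ha.1.trans h, ha.2⟩
  choose b hb using hρ
  let m := ∑ c : C, ∑ i, (b c).toAdd i
  have hshift : ∀ N c d, (A N c).card ≤ (A (N + m) d).card := by
    intro N c d
    refine Finset.card_le_card_of_injOn (fun a => a + (b (d / c)).toAdd) ?_ ?_
    · intro a ha
      simp only [A, Finset.coe_filter, Set.mem_ofPred_eq, hS] at ha ⊢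
      refine ⟨?_, ?_⟩
      · simp only [Pi.add_apply, Finset.sum_add_distrib]
        have : ∑ i, (b (d / c)).toAdd i ≤ m :=
          Finset.single_le_sum (f := fun c : C => ∑ i, (b c).toAdd i)
            (fun _ _ => Nat.zero_le _) (Finset.mem_univ (d / c))
        omega
      · rw [ofAdd_add, map_mul, ha.2, ofAdd_toAdd, hb]
        simp
    · intro a _ a' _ h
      exact add_right_cancel h
  have hdiff : ∀ N d, ((A (N + m) d).card : ℝ) - (A N d).card ≤ (S (N + m)).card - (S N).card := by
    intro N d
    rw [hsum, hsum]
    push_cast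
    rw [← Finset.sum_sub_distrib]
    refine Finset.single_le_sum (f := fun d => ((A (N + m) d).card : ℝ) - (A N d).card) ?_
      (Finset.mem_univ d)
    intro c _
    have := hmono N (N + m) (by omega) c
    rw [sub_nonneg]
    exact_mod_cast this
  have hkey : ∀ N c d, |((A N c).card : ℝ) - (A N d).card| ≤ (S (N + m)).card - (S N).card := by
    intro N c d
    have h1 : ((A N c).card : ℝ) ≤ (A (N + m) d).card := by exact_mod_cast hshift N c d
    have h2 : ((A N d).card : ℝ) ≤ (A (N + m) c).card := by exact_mod_cast hshift N d c
    have := hdiff N c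
    have := hdiff N d
    rw [abs_le]
    constructor <;> linarith
  refine ⟨m, fun N c => ?_⟩
  rw [hA, hD, hD, Nat.card_eq_fintype_card]
  have h1 : (Fintype.card C : ℝ) * (A N c).card - (S N).card =
      ∑ d, (((A N c).card : ℝ) - (A N d).card) := by
    rw [Finset.sum_sub_distrib, hsum]
    simp
  rw [h1]
  refine (Finset.abs_sum_le_sum_abs _ _).trans ?_
  refine (Finset.sum_le_sum fun d _ => hkey N c d).trans ?_
  rw [Finset.sum_const, nsmul_eq_mul, Finset.card_univ]


/-- For an algebraically closed field `k`, `ν ≥ 1`, a finite subgroup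
`G` of `(kˣ)^ν` and a character `χ : G → kˣ`, the density of `a ∈ ℕ^ν` with
`ρ_a = χ` (where `ρ_a (g) = ∏ i, g i ^ a i`) among all `a ∈ ℕ^ν`, counted over
the dilated simplices `{a : |a| ≤ N}`, tends to `1 / card G`. -/
theorem symmetric_signature_density {k : Type*} [Field k] [IsAlgClosed k]
    (ν : ℕ) (hν : 1 ≤ ν) (G : Subgroup (Fin ν → kˣ)) [Finite G] (χ : G →* kˣ) :
    Filter.Tendsto
      (fun N : ℕ =>
        (Nat.card {a : Fin ν → ℕ | (∑ i, a i) ≤ N ∧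
            ∀ g : G, (∏ i, (g : Fin ν → kˣ) i ^ (a i)) = χ g} : ℝ) /
        (Nat.card {a : Fin ν → ℕ | (∑ i, a i) ≤ N} : ℝ))
      Filter.atTop (nhds (1 / (Nat.card G : ℝ))) := by
  obtain ⟨hs, hc⟩ := aux_surj G
  have := aux_dual_finite (k := k) (A := G)
  obtain ⟨m, hm⟩ := aux_equi (auxRho G) hs
  rw [hc] at hm
  have hset : ∀ N : ℕ, {a : Fin ν → ℕ | (∑ i, a i) ≤ N ∧
            ∀ g : G, (∏ i, (g : Fin ν → kˣ) i ^ (a i)) = χ g} =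
      {a : Fin ν → ℕ | (∑ i, a i) ≤ N ∧ auxRho G (.ofAdd a) = χ} := by
    intro N
    ext a
    simp only [Set.mem_ofPred_eq, DFunLike.ext_iff]
    rfl
  simp only [hset]
  have hr := aux_ratio (fun N => Nat.card {a : Fin ν → ℕ | (∑ i, a i) ≤ N}) ν (aux_card ν) m
  have hG : (0 : ℝ) < Nat.card G := by exact_mod_cast Nat.card_pos
  rw [tendsto_iff_dist_tendsto_zero]
  have hr' := hr.sub_const 1
  rw [sub_self] at hr'
  refine squeeze_zero (fun _ => dist_nonneg) (fun N => ?_) hr'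
  have hD : (0 : ℝ) < Nat.card {a : Fin ν → ℕ | (∑ i, a i) ≤ N} := by
    rw [aux_card]
    exact_mod_cast Nat.choose_pos (by omega)
  have h := hm N χ
  generalize (Nat.card {a : Fin ν → ℕ | (∑ i, a i) ≤ N} : ℝ) = D at *
  generalize (Nat.card {a : Fin ν → ℕ | (∑ i, a i) ≤ N + m} : ℝ) = D' at *
  generalize (Nat.card {a : Fin ν → ℕ | (∑ i, a i) ≤ N ∧ auxRho G (.ofAdd a) = χ} : ℝ) = x at *
  generalize (Nat.card G : ℝ) = n at *
  have e1 : x / D - 1 / n = (n * x - D) / (n * D) := by field_simp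
  have e2 : D' / D - 1 = (n * (D' - D)) / (n * D) := by field_simp
  rw [Real.dist_eq, e1, e2, abs_div, abs_of_pos (mul_pos hG hD)]
  gcongr
end

section
/- Let n ≥ 1 and ν ≥ 1 be natural numbers and let H be a subgroup of (ℤ/nℤ)^ν. Let ℓ : ℤ^ν → Hom(H, ℤ/nℤ) be the group homomorphism sending x to the homomorphism y ↦ Σ_{i=1}^{ν} x_i y_i (computed in ℤ/nℤ), and let L be the kernel of ℓ. Then L is a subgroup of ℤ^ν of finite index, and the index [ℤ^ν : L] equals card(H). -/
/-- The pairing map `ℓ : ℤ^ν → Hom(H, ℤ/nℤ)`, sending `x` to the homomorphism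
`y ↦ ∑ i, x i * y i` (computed in `ℤ/nℤ`). -/
def pairingHom (n ν : ℕ) (H : AddSubgroup (Fin ν → ZMod n)) :
    (Fin ν → ℤ) →+ (H →+ ZMod n) where
  toFun x :=
    { toFun := fun y => ∑ i, (x i : ZMod n) * (y : Fin ν → ZMod n) i
      map_zero' := by simp
      map_add' := by
        intro y z
        simp [mul_add, Finset.sum_add_distrib] }
  map_zero' := by
    ext y
    simp
  map_add' := by
    intro x z
    ext y
    simp [add_mul, Finset.sum_add_distrib]

theorem finite_hom_zmod (n : ℕ) [NeZero n] (A : Type) [AddCommGroup A] [Finite A] :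
    Finite (A →+ ZMod n) :=
  Finite.of_injective (fun f : A →+ ZMod n => (f : A → ZMod n)) DFunLike.coe_injective

theorem card_hom_le (n : ℕ) [NeZero n] (A : Type) [AddCommGroup A] [Finite A] :
    Nat.card (A →+ ZMod n) ≤ Nat.card A := by
  letI := Fintype.ofFinite A
  have h : Nat.card (AddChar A ℂ) = Nat.card A := by
    rw [Nat.card_eq_fintype_card, Nat.card_eq_fintype_card, AddChar.card_eq]
  rw [← h]
  refine Nat.card_le_card_of_injective
    (fun f : A →+ ZMod n => (ZMod.stdAddChar (N := n)).compAddMonoidHom f) ?_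
  intro f g hfg
  ext a
  apply ZMod.injective_stdAddChar
  exact DFunLike.congr_fun hfg a

/-- The kernel `L` of `ℓ : ℤ^ν → Hom(H, ℤ/nℤ)` has finite index in
`ℤ^ν`, and `[ℤ^ν : L] = card H`. -/
theorem index_ker_pairing (n ν : ℕ) (hn : 1 ≤ n) (hν : 1 ≤ ν)
    (H : AddSubgroup (Fin ν → ZMod n)) :
    (pairingHom n ν H).ker.index ≠ 0 ∧
      (pairingHom n ν H).ker.index = Nat.card H := by
  have : NeZero n := ⟨by omega⟩
  have key : (pairingHom n ν H).ker.index = Nat.card H := by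
    rw [AddSubgroup.index_ker]
    have := finite_hom_zmod n H
    have := finite_hom_zmod n (pairingHom n ν H).range
    apply le_antisymm
    · exact (Nat.card_le_card_of_injective _ Subtype.val_injective).trans (card_hom_le n H)
    · refine le_trans ?_ (card_hom_le n (pairingHom n ν H).range)
      refine Nat.card_le_card_of_injective
        (fun y : H => (AddMonoidHom.eval y).comp (pairingHom n ν H).range.subtype) ?_
      intro y z hyz
      ext i
      have this : pairingHom n ν H (Pi.single i 1) y = pairingHom n ν H (Pi.single i 1) z :=
        DFunLike.congr_fun hyz ⟨pairingHom n ν H (Pi.single i 1), _, rfl⟩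
      simpa [pairingHom, Pi.single_apply] using this
  refine ⟨?_, key⟩
  rw [key]
  exact Nat.card_pos.ne'
end

section
/- Let n ≥ 1 and ν ≥ 1 be natural numbers and let H be a subgroup of (ℤ/nℤ)^ν. Then the group homomorphism ℓ : ℤ^ν → Hom(H, ℤ/nℤ) sending x to the homomorphism y ↦ Σ_{i=1}^{ν} x_i y_i (computed in ℤ/nℤ) is surjective; that is, every group homomorphism H → ℤ/nℤ is of the form y ↦ Σ_i x_i y_i for some x ∈ ℤ^ν. -/
/-- If every multiplier killing `a` also kills `c` then `a` divides `c` in `ZMod n`. -/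
theorem zmod_dvd_of_annihilator (n : ℕ) (hn : 1 ≤ n) (a c : ZMod n)
    (h : ∀ k : ZMod n, k * a = 0 → k * c = 0) : ∃ e : ZMod n, c = e * a := by
  haveI : NeZero n := ⟨by omega⟩
  obtain ⟨k, hk⟩ := Nat.gcd_dvd_right a.val n
  obtain ⟨b, hb⟩ := Nat.gcd_dvd_left a.val n
  have hbez := Nat.gcd_eq_gcd_ab a.val n
  set g := Nat.gcd a.val n with hg
  have hkpos : 0 < k := by
    rcases Nat.eq_zero_or_pos k with h0 | h0
    · subst h0; omega
    · exact h0
  have hka : (k : ZMod n) * a = 0 := by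
    rw [← ZMod.natCast_zmod_val a, ← Nat.cast_mul, ZMod.natCast_eq_zero_iff, hb]
    exact ⟨b, by rw [mul_left_comm, ← mul_assoc, ← hk]⟩
  have hkc := h _ hka
  rw [← ZMod.natCast_zmod_val c, ← Nat.cast_mul, ZMod.natCast_eq_zero_iff] at hkc
  have hgc : g ∣ c.val := by
    obtain ⟨t, ht⟩ := hkc
    refine ⟨t, Nat.eq_of_mul_eq_mul_left hkpos ?_⟩
    rw [ht]
    conv_lhs => rw [hk]
    ring
  obtain ⟨t, ht⟩ := hgc
  have hga : (g : ZMod n) = a * ((Nat.gcdA a.val n : ℤ) : ZMod n) := by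
    have := congrArg (Int.cast : ℤ → ZMod n) hbez
    push_cast at this
    simpa using this
  refine ⟨((Nat.gcdA a.val n : ℤ) : ZMod n) * t, ?_⟩
  rw [← ZMod.natCast_zmod_val c, ht, Nat.cast_mul, hga]
  ring

theorem zmod_self_baer (n : ℕ) (hn : 1 ≤ n) : Module.Baer (ZMod n) (ZMod n) := by
  intro I f
  haveI : IsPrincipalIdealRing (ZMod n) :=
    IsPrincipalIdealRing.of_surjective (Int.castRingHom (ZMod n)) (ZMod.ringHom_surjective _)
  obtain ⟨a, rfl⟩ := (IsPrincipalIdealRing.principal I).principal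
  have ha : a ∈ Submodule.span (ZMod n) {a} := Submodule.mem_span_singleton_self a
  obtain ⟨e, he⟩ := zmod_dvd_of_annihilator n hn a (f ⟨a, ha⟩) (by
    intro k hk
    rw [← smul_eq_mul, ← map_smul]
    have : k • (⟨a, ha⟩ : Submodule.span (ZMod n) {a}) = 0 := Subtype.ext hk
    rw [this, map_zero])
  refine ⟨LinearMap.mulLeft (ZMod n) e, ?_⟩
  intro x hx
  obtain ⟨r, rfl⟩ := Submodule.mem_span_singleton.1 hx
  have : (⟨r • a, hx⟩ : Submodule.span (ZMod n) {a}) = r • ⟨a, ha⟩ := rfl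
  rw [this, map_smul f, he]
  simp only [LinearMap.mulLeft_apply, smul_eq_mul]
  ring

/-- The pairing map `ℓ : ℤ^ν → Hom(H, ℤ/nℤ)` is surjective: every
group homomorphism `H → ℤ/nℤ` is of the form `y ↦ ∑ i, x i * y i` for some
`x ∈ ℤ^ν`. -/
theorem pairingHom_surjective (n ν : ℕ) (hn : 1 ≤ n) (hν : 1 ≤ ν)
    (H : AddSubgroup (Fin ν → ZMod n)) :
    Function.Surjective (pairingHom n ν H) := by
  intro f
  haveI := (zmod_self_baer n hn).injective
  let K : Submodule (ZMod n) (Fin ν → ZMod n) := AddSubgroup.toZModSubmodule n H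
  let f' : K →ₗ[ZMod n] ZMod n := AddMonoidHom.toZModLinearMap n (f : K →+ ZMod n)
  obtain ⟨F, hF⟩ := Module.Injective.out K.subtype K.injective_subtype f'
  refine ⟨fun i => ((F (Pi.single i 1)).cast : ℤ), ?_⟩
  ext y
  have h1 : F (y : Fin ν → ZMod n) = f y := hF y
  rw [← h1, LinearMap.pi_apply_eq_sum_univ F]
  change ∑ i, (((F (Pi.single i 1)).cast : ℤ) : ZMod n) * (y : Fin ν → ZMod n) i = _
  refine Finset.sum_congr rfl fun i _ => ?_
  rw [ZMod.intCast_zmod_cast, smul_eq_mul, mul_comm]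
  congr 2
  ext j
  simp [Pi.single_apply, eq_comm]
end

section
/- Let k be an algebraically closed field, let ν ≥ 1, and let G be a finite subgroup of (kˣ)^ν. Then the group homomorphism ρ : ℤ^ν → Hom(G, kˣ) sending a to the character g ↦ ∏_{i=1}^{ν} g_i^{a_i} is surjective; that is, every group homomorphism G → kˣ is a monomial character g ↦ ∏_i g_i^{a_i} for some a ∈ ℤ^ν. -/
/-- The exponent of a finite subgroup of a torus is invertible in the field. -/
theorem exponent_ne_zero_in_field {k : Type*} [Field k]
    (ν : ℕ) (G : Subgroup (Fin ν → kˣ)) [Finite G] :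
    ((Monoid.exponent G : ℕ) : k) ≠ 0 := by
  intro h
  obtain ⟨p, hp⟩ := CharP.exists k
  have hdvd : p ∣ Monoid.exponent G := (CharP.cast_eq_zero_iff k p _).1 h
  have hcard : p ∣ Nat.card G := hdvd.trans Group.exponent_dvd_nat_card
  rcases CharP.char_is_prime_or_zero k p with hpp | rfl
  · haveI : Fact p.Prime := ⟨hpp⟩
    obtain ⟨g, hg⟩ := exists_prime_orderOf_dvd_card' p hcard
    have h1 : g ^ p = 1 := hg ▸ pow_orderOf_eq_one g
    have h2 : g = 1 := by
      apply Subtype.ext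
      funext i
      apply Units.ext
      have h3 : (((g : Fin ν → kˣ) i : kˣ) : k) ^ p = 1 := by
        have := congrArg (fun x : G => (((x : Fin ν → kˣ) i : kˣ) : k)) h1
        simpa using this
      apply frobenius_inj k p
      simpa [frobenius_def] using h3
    rw [h2, orderOf_one] at hg
    exact hpp.one_lt.ne hg
  · exact Nat.card_pos.ne' (Nat.eq_zero_of_zero_dvd hcard)

/-- For an algebraically closed field `k`, `ν ≥ 1` and a finite
subgroup `G` of `(kˣ)^ν`, every group homomorphism `χ : G → kˣ` is a monomial
character: there is `a ∈ ℤ^ν` with `χ g = ∏ i, g i ^ a i` for all `g ∈ G`. -/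
theorem monomial_characters_surjective {k : Type*} [Field k] [IsAlgClosed k]
    (ν : ℕ) (hν : 1 ≤ ν) (G : Subgroup (Fin ν → kˣ)) [Finite G] :
    ∀ χ : G →* kˣ, ∃ a : Fin ν → ℤ,
      ∀ g : G, (∏ i, (g : Fin ν → kˣ) i ^ (a i)) = χ g := by
  haveI : NeZero ((Monoid.exponent G : ℕ) : k) := ⟨exponent_ne_zero_in_field ν G⟩
  let Φ : Subgroup (G →* kˣ) :=
    { carrier := {χ | ∃ a : Fin ν → ℤ, ∀ g : G, (∏ i, (g : Fin ν → kˣ) i ^ (a i)) = χ g}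
      one_mem' := ⟨0, by simp⟩
      mul_mem' := by
        rintro χ ψ ⟨a, ha⟩ ⟨b, hb⟩
        exact ⟨a + b, fun g => by
          simp [zpow_add, Finset.prod_mul_distrib, ha, hb]⟩
      inv_mem' := by
        rintro χ ⟨a, ha⟩
        exact ⟨-a, fun g => by simp [ha]⟩ }
  have key : (CommGroup.subgroupOrderIsoSubgroupMonoidHom G k).symm (OrderDual.toDual Φ) = ⊥ := by
    rw [eq_bot_iff]
    intro g hg
    rw [CommGroup.mem_subgroupOrderIsoSubgroupMonoidHom_symm_iff] at hg
    rw [Subgroup.mem_bot]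
    apply Subtype.ext
    funext j
    have hm : (Pi.evalMonoidHom (fun _ : Fin ν => kˣ) j).comp G.subtype ∈ Φ := by
      refine ⟨Pi.single j 1, fun g => ?_⟩
      rw [Finset.prod_eq_single j] <;> simp +contextual [Pi.single_apply]
    simpa using hg _ hm
  have top : Φ = ⊤ := by
    have h2 := (OrderIso.symm_apply_eq _).1 key
    rw [OrderIso.map_bot] at h2
    exact congrArg OrderDual.ofDual h2
  intro χ
  have : χ ∈ Φ := top ▸ Subgroup.mem_top χ
  exact this
end

section
/- Let k be an algebraically closed field, let ν ≥ 1, let G be a finite subgroup of (kˣ)^ν, and let χ : G → kˣ be a group homomorphism. Then there exist a subgroup L ⊆ ℤ^ν with [ℤ^ν : L] = card(G) and a point a₀ ∈ ℤ^ν such that for every a ∈ ℤ^ν with all coordinates nonnegative, the character ρ_a (defined by ρ_a(g) = ∏_i g_i^{a_i}) equals χ if and only if a ∈ a₀ + L. Consequently, for every natural number q, the set {a ∈ ℕ^ν : a_1 + ⋯ + a_ν = q and ρ_a = χ} equals {a ∈ ℕ^ν : a_1 + ⋯ + a_ν = q} ∩ (a₀ + L). -/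
/-- The homomorphism `a ↦ ρ_a`. -/
def rhoHom {k : Type*} [Field k] {ν : ℕ} (G : Subgroup (Fin ν → kˣ)) :
    (Fin ν → ℤ) →+ Additive (G →* kˣ) where
  toFun a := Additive.ofMul
    { toFun := fun g => ∏ i, (g : Fin ν → kˣ) i ^ (a i)
      map_one' := by simp
      map_mul' := fun x y => by simp [mul_zpow, Finset.prod_mul_distrib] }
  map_zero' := by
    apply Additive.toMul.injective
    ext g
    simp
  map_add' a b := by
    apply Additive.toMul.injective
    ext g
    simp [zpow_add, Finset.prod_mul_distrib]

theorem rhoHom_apply {k : Type*} [Field k] {ν : ℕ} (G : Subgroup (Fin ν → kˣ))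
    (a : Fin ν → ℤ) (g : G) :
    (rhoHom G a).toMul g = ∏ i, (g : Fin ν → kˣ) i ^ (a i) := rfl

theorem neZero_exponent_cast {k : Type*} [Field k] {ν : ℕ} (G : Subgroup (Fin ν → kˣ))
    [Finite G] : NeZero ((Monoid.exponent G : ℕ) : k) := by
  refine ⟨fun h => ?_⟩
  obtain ⟨p, hp⟩ := CharP.exists k
  have hdvd : p ∣ Monoid.exponent G := (CharP.cast_eq_zero_iff k p _).1 h
  have hne : Monoid.exponent G ≠ 0 := Monoid.exponent_ne_zero_of_finite
  have hp0 : p ≠ 0 := by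
    rintro rfl
    exact hne (Nat.eq_zero_of_zero_dvd hdvd)
  have hpp : p.Prime := (CharP.char_is_prime_or_zero k p).resolve_right hp0
  have : Fact p.Prime := ⟨hpp⟩
  obtain ⟨g, hg⟩ := exists_prime_orderOf_dvd_card' (G := G) p
    (hdvd.trans Group.exponent_dvd_nat_card)
  have h1 : g ^ p = 1 := by rw [← hg]; exact pow_orderOf_eq_one g
  have h2 : g = 1 := by
    ext i
    have h3 : ((g : Fin ν → kˣ) i : k) ^ p = 1 := by
      have := congrArg (fun x : G => (((x : Fin ν → kˣ) i : kˣ) : k)) h1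
      simpa using this
    have h4 : (((g : Fin ν → kˣ) i : k) - 1) ^ p = 0 := by
      rw [sub_pow_char, h3]; simp
    have h5 := sub_eq_zero.1 (pow_eq_zero_iff hp0 |>.1 h4)
    simpa using h5
  rw [h2, orderOf_one] at hg
  exact hpp.one_lt.ne hg

theorem rhoHom_surjective {k : Type*} [Field k] {ν : ℕ} (G : Subgroup (Fin ν → kˣ))
    [Finite G] [HasEnoughRootsOfUnity k (Monoid.exponent G)] :
    Function.Surjective (rhoHom G) := by
  let R : Subgroup (G →* kˣ) := AddSubgroup.toSubgroup' (rhoHom G).range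
  have hR : ∀ a, (rhoHom G a).toMul ∈ R := fun a => ⟨a, rfl⟩
  have hbot : (CommGroup.subgroupOrderIsoSubgroupMonoidHom G k).symm (OrderDual.toDual R) = ⊥ := by
    rw [eq_bot_iff]
    intro g hg
    rw [CommGroup.mem_subgroupOrderIsoSubgroupMonoidHom_symm_iff] at hg
    rw [Subgroup.mem_bot]
    ext i
    have := hg _ (hR (Pi.single i 1))
    rw [rhoHom_apply, Finset.prod_eq_single i] at this
    · simpa using this
    · intro j _ hj
      simp [hj]
    · simp
  have htop : R = ⊤ := by
    have h1 := (CommGroup.subgroupOrderIsoSubgroupMonoidHom G k).symm_apply_eq.1 hbot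
    rw [map_bot] at h1
    exact h1
  intro φ
  have : φ.toMul ∈ R := htop ▸ Subgroup.mem_top _
  exact this


theorem index_eq_card_of_fibers {A B : Type*} [AddCommGroup A] (L : AddSubgroup A) (f : A → B)
    (hs : Function.Surjective f) (h : ∀ a b, -a + b ∈ L ↔ f a = f b) :
    L.index = Nat.card B := by
  refine Nat.card_congr (Equiv.ofBijective
    (Quotient.lift f fun a b hab => (h a b).1 (QuotientAddGroup.leftRel_apply.1 hab)) ⟨?_, ?_⟩)
  · rintro ⟨a⟩ ⟨b⟩ hab
    exact Quotient.sound (QuotientAddGroup.leftRel_apply.2 ((h a b).2 hab))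
  · intro b
    obtain ⟨a, rfl⟩ := hs b
    exact ⟨Quotient.mk _ a, rfl⟩

/-- For an algebraically closed field `k`, `ν ≥ 1`, a finite subgroup
`G` of `(kˣ)^ν` and a character `χ : G → kˣ`, there are a subgroup `L ⊆ ℤ^ν` of
index `card G` and `a₀ ∈ ℤ^ν` such that for every `a ∈ ℤ^ν` with nonnegative
coordinates, `ρ_a = χ` iff `a ∈ a₀ + L`; consequently, for every `q`, the set of
`a ∈ ℕ^ν` with `|a| = q` and `ρ_a = χ` equals the intersection of
`{a ∈ ℕ^ν : |a| = q}` with the coset `a₀ + L`. -/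
theorem character_fiber_is_coset {k : Type*} [Field k] [IsAlgClosed k]
    (ν : ℕ) (hν : 1 ≤ ν) (G : Subgroup (Fin ν → kˣ)) [Finite G] (χ : G →* kˣ) :
    ∃ (L : AddSubgroup (Fin ν → ℤ)) (a₀ : Fin ν → ℤ),
      L.index = Nat.card G ∧
      (∀ a : Fin ν → ℤ, (∀ i, 0 ≤ a i) →
        ((∀ g : G, (∏ i, (g : Fin ν → kˣ) i ^ (a i)) = χ g) ↔ ∃ x ∈ L, a = a₀ + x)) ∧
      (∀ q : ℕ,
        {a : Fin ν → ℤ | (∀ i, 0 ≤ a i) ∧ (∑ i, a i) = q ∧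
            ∀ g : G, (∏ i, (g : Fin ν → kˣ) i ^ (a i)) = χ g} =
          {a : Fin ν → ℤ | (∀ i, 0 ≤ a i) ∧ (∑ i, a i) = q} ∩
            {a : Fin ν → ℤ | ∃ x ∈ L, a = a₀ + x}) := by
  have := neZero_exponent_cast G
  have : HasEnoughRootsOfUnity k (Monoid.exponent G) := inferInstance
  have hs := rhoHom_surjective G
  obtain ⟨a₀, ha₀⟩ := hs (Additive.ofMul χ)
  have key : ∀ a : Fin ν → ℤ, ((∀ g : G, (∏ i, (g : Fin ν → kˣ) i ^ (a i)) = χ g) ↔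
      ∃ x ∈ (rhoHom G).ker, a = a₀ + x) := by
    intro a
    have h1 : (∀ g : G, (∏ i, (g : Fin ν → kˣ) i ^ (a i)) = χ g) ↔
        rhoHom G a = Additive.ofMul χ :=
      ⟨fun h => Additive.toMul.injective (MonoidHom.ext h), fun h g => by
        rw [← rhoHom_apply, h]; rfl⟩
    rw [h1]
    constructor
    · intro h
      refine ⟨a - a₀, ?_, by abel⟩
      rw [AddMonoidHom.mem_ker, map_sub, h, ha₀]
      exact sub_self (Additive.ofMul χ)
    · rintro ⟨x, hx, rfl⟩
      rw [map_add, ha₀, (AddMonoidHom.mem_ker).1 hx, add_zero]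
  refine ⟨(rhoHom G).ker, a₀, ?_, fun a _ => key a, fun q => ?_⟩
  · rw [← CommGroup.card_monoidHom_of_hasEnoughRootsOfUnity G k]
    refine index_eq_card_of_fibers _ (fun a => (rhoHom G a).toMul) hs fun a b => ?_
    rw [AddMonoidHom.mem_ker, map_add, map_neg]
    exact neg_add_eq_zero (a := rhoHom G a)
  · ext a
    simp only [Set.mem_ofPred_eq, Set.mem_inter_iff, key a, and_assoc]
end

section
/- Let ν ≥ 1, let L be a finite-index subgroup of ℤ^ν, and let a₀ ∈ ℤ^ν. For a natural number N, let f(N) be the cardinality of the set {x ∈ ℤ^ν : x ∈ a₀ + L, x_i ≥ 0 for all i, and x_1 + ⋯ + x_ν ≤ N}. Then the sequence f(N)/N^ν converges as N → ∞ to 1/(ν! · [ℤ^ν : L]). -/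
/-- Integer points of the dilated simplex. -/
def simplexPts (ν N : ℕ) : Set (Fin ν → ℤ) := {x | (∀ i, 0 ≤ x i) ∧ (∑ i, x i) ≤ (N : ℤ)}

lemma simplexPts_finite (ν N : ℕ) : (simplexPts ν N).Finite := by
  apply (Set.finite_Icc (0 : Fin ν → ℤ) (fun _ => (N : ℤ))).subset
  rintro x ⟨h0, h1⟩
  refine ⟨fun i => h0 i, fun i => ?_⟩
  exact (Finset.single_le_sum (f := x) (fun j _ => h0 j) (Finset.mem_univ i)).trans h1

lemma simplexPts_card (ν N : ℕ) : Nat.card (simplexPts ν N) = (N + ν).choose ν := by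
  have h := Finset.card_finsuppAntidiag_nat_eq_choose
    (s := (Finset.univ : Finset (Fin (ν + 1)))) N
  have h2 : (N + ν).choose ν =
      (Finset.finsuppAntidiag (Finset.univ : Finset (Fin (ν + 1))) N).card := by
    rw [h, Finset.card_univ, Fintype.card_fin]
    rw [show ν + 1 + N - 1 = N + ν by omega]
    exact (Nat.choose_symm_add).symm
  rw [h2, ← Nat.card_eq_finsetCard]
  symm
  refine Nat.card_eq_of_bijective (fun f => ⟨fun i => (f.1 i.succ : ℤ), ?_, ?_⟩) ⟨?_, ?_⟩
  · intro i; positivity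
  · have := f.2
    simp only [Finset.mem_finsuppAntidiag, Fin.sum_univ_succ] at this
    have h3 := this.1
    have h4 : ∑ i : Fin ν, f.1 i.succ ≤ N := by omega
    show ∑ i : Fin ν, (f.1 i.succ : ℤ) ≤ N
    exact_mod_cast h4
  · rintro ⟨f, hf⟩ ⟨g, hg⟩ hfg
    simp only [Finset.mem_finsuppAntidiag, Fin.sum_univ_succ] at hf hg
    have hfg' := congrArg Subtype.val hfg
    have h3 : ∀ i : Fin ν, f i.succ = g i.succ := fun i => by
      have h6 : (f i.succ : ℤ) = g i.succ := congrFun hfg' i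
      exact_mod_cast h6
    have h4 := hf.1
    have h5 := hg.1
    simp only [h3] at h4
    apply Subtype.ext
    ext i
    refine Fin.cases ?_ h3 i
    show f 0 = g 0
    omega
  · rintro ⟨x, hx0, hx1⟩
    have hs : ((∑ i, (x i).toNat : ℕ) : ℤ) = ∑ i, x i := by
      push_cast
      exact Finset.sum_congr rfl fun i _ => by simp [hx0 i]
    refine ⟨⟨Finsupp.equivFunOnFinite.symm
      (Fin.cons (N - ∑ i, (x i).toNat) (fun i => (x i).toNat)), ?_⟩, ?_⟩
    · simp only [Finset.mem_finsuppAntidiag, Fin.sum_univ_succ]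
      refine ⟨?_, by simp⟩
      simp only [Finsupp.equivFunOnFinite_symm_apply_apply, Fin.cons_zero, Fin.cons_succ]
      omega
    · apply Subtype.ext
      funext i
      simp [hx0 i]

/-- Points of a given residue class in the simplex. -/
def classPts {ν : ℕ} (L : AddSubgroup (Fin ν → ℤ)) (c : (Fin ν → ℤ) ⧸ L) (N : ℕ) :
    Set (Fin ν → ℤ) := {x | (x : (Fin ν → ℤ) ⧸ L) = c ∧ x ∈ simplexPts ν N}

lemma classPts_finite {ν : ℕ} (L : AddSubgroup (Fin ν → ℤ)) (c : (Fin ν → ℤ) ⧸ L) (N : ℕ) :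
    (classPts L c N).Finite := (simplexPts_finite ν N).subset fun _ h => h.2

lemma exists_rep {ν : ℕ} (L : AddSubgroup (Fin ν → ℤ)) (hL : L.index ≠ 0)
    (c : (Fin ν → ℤ) ⧸ L) :
    ∃ v ∈ simplexPts ν (ν * L.index), (v : (Fin ν → ℤ) ⧸ L) = c := by
  obtain ⟨w, rfl⟩ := QuotientAddGroup.mk_surjective c
  have hpos : (0 : ℤ) < L.index := by exact_mod_cast Nat.pos_of_ne_zero hL
  refine ⟨fun i => w i % L.index, ⟨fun i => Int.emod_nonneg _ hpos.ne', ?_⟩, ?_⟩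
  · calc ∑ i, w i % (L.index : ℤ) ≤ ∑ i : Fin ν, (L.index : ℤ) :=
        Finset.sum_le_sum fun i _ => (Int.emod_lt_of_pos _ hpos).le
      _ = _ := by simp
  · rw [QuotientAddGroup.eq]
    have := L.nsmul_index_mem (fun i => w i / (L.index : ℤ))
    convert this using 1
    funext i
    have := Int.emod_add_mul_ediv (w i) L.index
    simp
    linarith

lemma classPts_card_le {ν : ℕ} (L : AddSubgroup (Fin ν → ℤ)) (hL : L.index ≠ 0)
    (c d : (Fin ν → ℤ) ⧸ L) (N : ℕ) :
    Nat.card (classPts L c N) ≤ Nat.card (classPts L d (N + ν * L.index)) := by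
  obtain ⟨v, hv, hvc⟩ := exists_rep L hL (d - c)
  have := (classPts_finite L d (N + ν * L.index)).to_subtype
  refine Nat.card_le_card_of_injective
    (fun x : classPts L c N => (⟨x.1 + v, ?_, fun i => ?_, ?_⟩ : classPts L d _)) ?_
  · rw [QuotientAddGroup.mk_add, x.2.1, hvc]; abel
  · exact add_nonneg (x.2.2.1 i) (hv.1 i)
  · simp only [Pi.add_apply, Finset.sum_add_distrib]
    have h1 := x.2.2.2
    have h2 := hv.2
    push_cast at *
    linarith
  · intro x y h
    have h' : x.1 + v = y.1 + v := congrArg Subtype.val h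
    exact Subtype.ext (add_right_cancel h')

lemma sum_classPts {ν : ℕ} (L : AddSubgroup (Fin ν → ℤ)) [Fintype ((Fin ν → ℤ) ⧸ L)] (N : ℕ) :
    ∑ c, Nat.card (classPts L c N) = (N + ν).choose ν := by
  have := fun c => (classPts_finite L c N).to_subtype
  rw [← simplexPts_card, ← Nat.card_sigma]
  refine Nat.card_congr ⟨fun p => ⟨p.2.1, p.2.2.2⟩, fun x => ⟨x.1, x.1, rfl, x.2⟩, ?_, ?_⟩
  · rintro ⟨c, x, rfl, hx⟩; rfl
  · rintro x; rfl

lemma classPts_bounds {ν : ℕ} (L : AddSubgroup (Fin ν → ℤ)) (hL : L.index ≠ 0)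
    (c : (Fin ν → ℤ) ⧸ L) (N : ℕ) :
    L.index * Nat.card (classPts L c N) ≤ (N + ν * L.index + ν).choose ν ∧
    (N + ν).choose ν ≤ L.index * Nat.card (classPts L c (N + ν * L.index)) := by
  have : L.FiniteIndex := ⟨hL⟩
  let _ : Fintype ((Fin ν → ℤ) ⧸ L) := Fintype.ofFinite _
  have hi : L.index = Fintype.card ((Fin ν → ℤ) ⧸ L) := by
    rw [← Nat.card_eq_fintype_card]; rfl
  have hc : ∀ k : ℕ, L.index * k = ∑ _d : (Fin ν → ℤ) ⧸ L, k := fun k => by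
    rw [Finset.sum_const, Finset.card_univ, hi, smul_eq_mul]
  constructor
  · rw [← sum_classPts L, hc]
    exact Finset.sum_le_sum fun d _ => classPts_card_le L hL c d N
  · rw [← sum_classPts L, hc]
    exact Finset.sum_le_sum fun d _ => classPts_card_le L hL d c N

lemma tendsto_shift (ν : ℕ) (a C : ℝ) :
    Filter.Tendsto (fun N : ℕ => (((N : ℝ) + a) ^ ν / C) / (N : ℝ) ^ ν) Filter.atTop
      (nhds (1 / C)) := by
  have h1 : Filter.Tendsto (fun N : ℕ => (1 + a / (N : ℝ)) ^ ν / C) Filter.atTop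
      (nhds ((1 + 0) ^ ν / C)) :=
    ((tendsto_const_nhds.add (tendsto_const_div_atTop_nhds_zero_nat a)).pow ν).div_const C
  rw [add_zero, one_pow] at h1
  refine h1.congr' ?_
  filter_upwards [Filter.eventually_gt_atTop 0] with N hN
  have : (N : ℝ) ≠ 0 := by positivity
  rw [div_right_comm, ← div_pow, add_div, div_self this]

/-- For `ν ≥ 1`, a finite-index subgroup `L ⊆ ℤ^ν` and `a₀ ∈ ℤ^ν`,
the number `f(N)` of points of the coset `a₀ + L` with nonnegative coordinates and
coordinate sum at most `N` satisfies `f(N)/N^ν → 1/(ν! · [ℤ^ν : L])`. -/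
theorem coset_simplex_count_asymptotics (ν : ℕ) (hν : 1 ≤ ν)
    (L : AddSubgroup (Fin ν → ℤ)) (hL : L.index ≠ 0) (a₀ : Fin ν → ℤ) :
    Filter.Tendsto
      (fun N : ℕ =>
        (Nat.card {x : Fin ν → ℤ | (∃ y ∈ L, x = a₀ + y) ∧
            (∀ i, 0 ≤ x i) ∧ (∑ i, x i) ≤ (N : ℤ)} : ℝ) / (N : ℝ) ^ ν)
      Filter.atTop
      (nhds (1 / ((ν.factorial : ℝ) * (L.index : ℝ)))) := by
  have hm : (0 : ℝ) < L.index := by exact_mod_cast Nat.pos_of_ne_zero hL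
  have hset : ∀ N : ℕ, {x : Fin ν → ℤ | (∃ y ∈ L, x = a₀ + y) ∧
      (∀ i, 0 ≤ x i) ∧ (∑ i, x i) ≤ (N : ℤ)} = classPts L (a₀ : (Fin ν → ℤ) ⧸ L) N := by
    intro N
    ext x
    refine and_congr ?_ Iff.rfl
    rw [eq_comm, QuotientAddGroup.eq]
    constructor
    · rintro ⟨y, hy, rfl⟩
      simpa using hy
    · intro h
      exact ⟨_, h, by abel⟩
  simp only [hset]
  have hf : (0 : ℝ) < ν.factorial := by exact_mod_cast ν.factorial_pos
  refine tendsto_of_tendsto_of_tendsto_of_le_of_le'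
    (tendsto_shift ν (-(ν * L.index : ℕ)) (ν.factorial * L.index))
    (tendsto_shift ν ((ν * L.index + ν : ℕ)) (ν.factorial * L.index)) ?_ ?_
  · filter_upwards [Filter.eventually_ge_atTop (ν * L.index)] with N hN
    obtain ⟨M, rfl⟩ := Nat.exists_eq_add_of_le' hN
    have h1 := (classPts_bounds L hL (a₀ : (Fin ν → ℤ) ⧸ L) M).2
    have h2 := Nat.pow_le_choose (α := ℝ) ν (M + ν)
    have h3 : ((M : ℝ)) ^ ν ≤ ((M + ν + 1 - ν : ℕ) : ℝ) ^ ν := by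
      gcongr
      omega
    have h1' : (((M + ν).choose ν : ℕ) : ℝ) ≤
      L.index * Nat.card (classPts L (a₀ : (Fin ν → ℤ) ⧸ L) (M + ν * L.index)) := by
      exact_mod_cast h1
    gcongr
    rw [div_le_iff₀ (by positivity)]
    rw [div_le_iff₀ hf] at h2
    have h4 := mul_le_mul_of_nonneg_right h1' hf.le
    have h5 : ((M + ν * L.index : ℕ) : ℝ) + -((ν * L.index : ℕ) : ℝ) = M := by
      push_cast; ring
    rw [h5]
    linarith
  · refine Filter.Eventually.of_forall fun N => ?_
    have h1 := (classPts_bounds L hL (a₀ : (Fin ν → ℤ) ⧸ L) N).1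
    have h2 := Nat.choose_le_pow_div (α := ℝ) ν (N + ν * L.index + ν)
    have h1' : (L.index : ℝ) * Nat.card (classPts L (a₀ : (Fin ν → ℤ) ⧸ L) N) ≤
      (((N + ν * L.index + ν).choose ν : ℕ) : ℝ) := by
      exact_mod_cast h1
    gcongr
    rw [le_div_iff₀ (by positivity)]
    rw [le_div_iff₀ hf] at h2
    have h4 := mul_le_mul_of_nonneg_right h1' hf.le
    have h5 : ((N + ν * L.index + ν : ℕ) : ℝ) = N + ((ν * L.index + ν : ℕ) : ℝ) := by
      push_cast; ring
    rw [h5] at h2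
    linarith
end

section
/- Let ν ≥ 1, let L be a finite-index subgroup of ℤ^ν, and let a₀ ∈ ℤ^ν. For a natural number N, let f(N) = card {x ∈ ℤ^ν : x ∈ a₀ + L, x_i ≥ 0 for all i, x_1 + ⋯ + x_ν ≤ N} and g(N) = card {x ∈ ℤ^ν : x_i ≥ 0 for all i, x_1 + ⋯ + x_ν ≤ N}. Then the sequence f(N)/g(N) converges as N → ∞ to 1/[ℤ^ν : L]. -/
open Filter Topology in
theorem aux_choose_one (ν : ℕ) :
    Tendsto (fun n : ℕ => (((n + 1 + ν).choose ν : ℕ) : ℝ) / (((n + ν).choose ν : ℕ) : ℝ))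
      atTop (𝓝 1) := by
  have h1 : Tendsto (fun n : ℕ => 1 + (ν : ℝ) * (1 / ((n : ℝ) + 1))) atTop (𝓝 (1 + ν * 0)) :=
    tendsto_const_nhds.add (tendsto_const_nhds.mul tendsto_one_div_add_atTop_nhds_zero_nat)
  rw [mul_zero, add_zero] at h1
  refine h1.congr fun n => ?_
  have h2 := Nat.choose_mul_succ_eq (n + ν) ν
  have h3 : n + ν + 1 - ν = n + 1 := by omega
  rw [h3, show n + ν + 1 = n + 1 + ν by ring] at h2
  have h4 : (((n + ν).choose ν : ℕ) : ℝ) ≠ 0 := by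
    have := Nat.choose_pos (n := n + ν) (k := ν) (by omega)
    positivity
  have h5 : (((n + ν).choose ν : ℕ) : ℝ) * ((n : ℝ) + 1 + ν)
      = (((n + 1 + ν).choose ν : ℕ) : ℝ) * ((n : ℝ) + 1) := by exact_mod_cast h2
  have h6 : (n : ℝ) + 1 ≠ 0 := by positivity
  field_simp
  linarith

open Filter Topology in
theorem aux_choose (ν k : ℕ) :
    Tendsto (fun n : ℕ => (((n + k + ν).choose ν : ℕ) : ℝ) / (((n + ν).choose ν : ℕ) : ℝ))
      atTop (𝓝 1) := by
  have hp : ∀ n : ℕ, (((n + ν).choose ν : ℕ) : ℝ) ≠ 0 := fun n => by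
    have := Nat.choose_pos (n := n + ν) (k := ν) (by omega)
    positivity
  induction k with
  | zero => exact tendsto_const_nhds.congr fun n => (div_self (hp n)).symm
  | succ k ih =>
    have h := ((tendsto_add_atTop_iff_nat k).2 (aux_choose_one ν)).mul ih
    rw [mul_one] at h
    refine h.congr fun n => ?_
    have := hp (n + k)
    have := hp n
    rw [show n + (k + 1) + ν = n + k + 1 + ν by ring]
    field_simp

noncomputable def auxG (ν N : ℕ) : Finset (Fin ν → ℤ) :=
  (Fintype.piFinset fun _ => Finset.Icc (0 : ℤ) N).filter fun x => ∑ i, x i ≤ N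

theorem mem_auxG {ν N : ℕ} {x : Fin ν → ℤ} :
    x ∈ auxG ν N ↔ (∀ i, 0 ≤ x i) ∧ ∑ i, x i ≤ (N : ℤ) := by
  simp only [auxG, Finset.mem_filter, Fintype.mem_piFinset, Finset.mem_Icc]
  refine ⟨fun h => ⟨fun i => (h.1 i).1, h.2⟩, fun h => ⟨fun i => ⟨h.1 i, ?_⟩, h.2⟩⟩
  exact (Finset.single_le_sum (fun j _ => h.1 j) (Finset.mem_univ i)).trans h.2

theorem card_auxG (ν N : ℕ) : (auxG ν N).card = (N + ν).choose ν := by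
  rw [← Nat.sum_range_multichoose, Finset.card_eq_sum_card_fiberwise
    (f := fun x => (∑ i, x i).toNat) (t := Finset.range (N + 1))]
  · refine Finset.sum_congr rfl fun n hn => ?_
    have h := Finset.card_finsuppAntidiag_nat_eq_multichoose (s := (Finset.univ : Finset (Fin ν))) n
    rw [Finset.card_univ, Fintype.card_fin] at h
    rw [← h]
    refine Finset.card_nbij' (fun x => Finsupp.equivFunOnFinite.symm fun i => (x i).toNat)
      (fun y i => (y i : ℤ)) ?_ ?_ ?_ ?_
    · intro x hx
      simp only [Finset.coe_filter, mem_auxG, Set.mem_ofPred_eq] at hx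
      obtain ⟨⟨h0, h1⟩, h2⟩ := hx
      simp only [Finset.mem_coe, Finset.mem_finsuppAntidiag, Finset.subset_univ, and_true]
      have : ∑ i, ((x i).toNat : ℤ) = ∑ i, x i :=
        Finset.sum_congr rfl fun i _ => Int.toNat_of_nonneg (h0 i)
      have h3 : 0 ≤ ∑ i, x i := Finset.sum_nonneg fun i _ => h0 i
      have : ((∑ i, (x i).toNat : ℕ) : ℤ) = n := by push_cast; omega
      exact_mod_cast this
    · intro y hy
      simp only [Finset.mem_coe, Finset.mem_finsuppAntidiag, Finset.subset_univ, and_true] at hy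
      simp only [Finset.coe_filter, mem_auxG, Set.mem_ofPred_eq]
      have := Finset.mem_range.1 hn
      rw [← Nat.cast_sum, hy]
      exact ⟨⟨fun i => by positivity, by omega⟩, by omega⟩
    · intro x hx
      simp only [Finset.coe_filter, mem_auxG, Set.mem_ofPred_eq] at hx
      funext i
      exact Int.toNat_of_nonneg (hx.1.1 i)
    · intro y hy
      ext i
      simp
  · intro x hx
    have := (mem_auxG.1 hx).2
    simp only [Finset.coe_range, Set.mem_Iio]
    omega

theorem aux_rep (ν : ℕ) (L : AddSubgroup (Fin ν → ℤ)) (hL : L.index ≠ 0)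
    (q : (Fin ν → ℤ) ⧸ L) :
    ∃ t : Fin ν → ℤ, (∀ i, 0 ≤ t i) ∧ (QuotientAddGroup.mk t : (Fin ν → ℤ) ⧸ L) = q := by
  obtain ⟨y, rfl⟩ := QuotientAddGroup.mk_surjective q
  refine ⟨y + L.index • (fun i => |y i|), fun i => ?_, ?_⟩
  · have h1 : (1 : ℤ) ≤ L.index := by exact_mod_cast Nat.one_le_iff_ne_zero.2 hL
    change 0 ≤ y i + L.index • |y i|
    rw [nsmul_eq_mul]
    nlinarith [abs_nonneg (y i), neg_abs_le (y i)]
  · exact QuotientAddGroup.mk_add_of_mem _ (L.nsmul_index_mem _)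

open Classical in
theorem aux_shift (ν : ℕ) (L : AddSubgroup (Fin ν → ℤ)) (hL : L.index ≠ 0) :
    ∃ T : ℕ, ∀ (c d : (Fin ν → ℤ) ⧸ L) (N : ℕ),
      ((auxG ν N).filter fun x => (QuotientAddGroup.mk x : (Fin ν → ℤ) ⧸ L) = c).card ≤
      ((auxG ν (N + T)).filter fun x => (QuotientAddGroup.mk x : (Fin ν → ℤ) ⧸ L) = d).card := by
  choose t ht0 ht using aux_rep ν L hL
  have : Finite ((Fin ν → ℤ) ⧸ L) := Nat.finite_of_card_ne_zero hL
  have := Fintype.ofFinite ((Fin ν → ℤ) ⧸ L)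
  refine ⟨∑ q, (∑ i, t q i).toNat, fun c d N => ?_⟩
  refine Finset.card_le_card_of_injOn (fun x => x + t (d - c)) ?_
    (fun x _ y _ h => add_right_cancel h)
  intro x hx
  simp only [Finset.coe_filter, mem_auxG, Set.mem_ofPred_eq] at hx ⊢
  obtain ⟨⟨h0, h1⟩, h2⟩ := hx
  refine ⟨⟨fun i => add_nonneg (h0 i) (ht0 _ i), ?_⟩, ?_⟩
  · have h3 : (∑ i, t (d - c) i).toNat ≤ ∑ q, (∑ i, t q i).toNat :=
      Finset.single_le_sum (f := fun q => (∑ i, t q i).toNat) (fun _ _ => Nat.zero_le _)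
        (Finset.mem_univ (d - c))
    simp only [Pi.add_apply, Finset.sum_add_distrib]
    rw [Nat.cast_add]
    omega
  · rw [QuotientAddGroup.mk_add, h2, ht]
    abel

/-- For `ν ≥ 1`, a finite-index subgroup `L ⊆ ℤ^ν` and `a₀ ∈ ℤ^ν`,
the ratio between the number of points of the coset `a₀ + L` and the number of
points of `ℤ^ν` lying in the dilated standard simplex `N·Δ` converges to
`1/[ℤ^ν : L]` as `N → ∞`. -/
theorem coset_simplex_density (ν : ℕ) (hν : 1 ≤ ν)
    (L : AddSubgroup (Fin ν → ℤ)) (hL : L.index ≠ 0) (a₀ : Fin ν → ℤ) :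
    Filter.Tendsto
      (fun N : ℕ =>
        (Nat.card {x : Fin ν → ℤ | (∃ y ∈ L, x = a₀ + y) ∧
            (∀ i, 0 ≤ x i) ∧ (∑ i, x i) ≤ (N : ℤ)} : ℝ) /
        (Nat.card {x : Fin ν → ℤ | (∀ i, 0 ≤ x i) ∧ (∑ i, x i) ≤ (N : ℤ)} : ℝ))
      Filter.atTop (nhds (1 / (L.index : ℝ))) := by
  classical
  have : Finite ((Fin ν → ℤ) ⧸ L) := Nat.finite_of_card_ne_zero hL
  have := Fintype.ofFinite ((Fin ν → ℤ) ⧸ L)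
  have hidx : L.index = Fintype.card ((Fin ν → ℤ) ⧸ L) := by
    rw [AddSubgroup.index_eq_card, Nat.card_eq_fintype_card]
  set F : ((Fin ν → ℤ) ⧸ L) → ℕ → ℕ := fun c N =>
    ((auxG ν N).filter fun x => (QuotientAddGroup.mk x : (Fin ν → ℤ) ⧸ L) = c).card with hF
  set c₀ : (Fin ν → ℤ) ⧸ L := QuotientAddGroup.mk a₀ with hc₀
  set g : ℕ → ℕ := fun N => (N + ν).choose ν with hg
  have hcg : ∀ N : ℕ, Nat.card {x : Fin ν → ℤ | (∀ i, 0 ≤ x i) ∧ (∑ i, x i) ≤ (N : ℤ)} = g N := by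
    intro N
    change _ = (N + ν).choose ν
    rw [← card_auxG]
    exact Nat.subtype_card _ fun x => mem_auxG
  have hcf : ∀ N : ℕ, Nat.card {x : Fin ν → ℤ | (∃ y ∈ L, x = a₀ + y) ∧
      (∀ i, 0 ≤ x i) ∧ (∑ i, x i) ≤ (N : ℤ)} = F c₀ N := by
    intro N
    refine Nat.subtype_card _ fun x => ?_
    rw [Finset.mem_filter, mem_auxG, and_comm, Set.mem_ofPred_eq]
    refine and_congr_left fun _ => ?_
    rw [hc₀, eq_comm, QuotientAddGroup.eq]
    constructor
    · intro h
      exact ⟨_, h, by abel⟩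
    · rintro ⟨y, hy, rfl⟩
      simpa using hy
  have hsum : ∀ N, g N = ∑ c, F c N := by
    intro N
    rw [hg]
    simp only [← card_auxG]
    exact Finset.card_eq_sum_card_fiberwise fun _ _ => by simp
  obtain ⟨T, hT⟩ := aux_shift ν L hL
  have hlo : ∀ N, g N ≤ L.index * F c₀ (N + T) := by
    intro N
    rw [hsum, hidx]
    calc _ ≤ ∑ c : (Fin ν → ℤ) ⧸ L, F c₀ (N + T) := Finset.sum_le_sum fun c _ => hT c c₀ N
      _ = _ := by simp
  have hhi : ∀ N, L.index * F c₀ N ≤ g (N + T) := by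
    intro N
    rw [hsum, hidx]
    calc _ = ∑ c : (Fin ν → ℤ) ⧸ L, F c₀ N := by simp
      _ ≤ _ := Finset.sum_le_sum fun c _ => hT c₀ c N
  have hgpos : ∀ N, (0 : ℝ) < g N := fun N => by
    have := Nat.choose_pos (n := N + ν) (k := ν) (by omega)
    exact_mod_cast this
  have hm : (0 : ℝ) < L.index := by exact_mod_cast Nat.pos_of_ne_zero hL
  simp only [hcg, hcf]
  rw [← Filter.tendsto_add_atTop_iff_nat T]
  have hlim : Filter.Tendsto (fun n : ℕ => (g (n + T) : ℝ) / g n) Filter.atTop (nhds 1) :=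
    aux_choose ν T
  have hl := (hlim.inv₀ one_ne_zero).div_const (L.index : ℝ)
  have hu := (((Filter.tendsto_add_atTop_iff_nat T).2 hlim)).div_const (L.index : ℝ)
  rw [inv_one] at hl
  refine tendsto_of_tendsto_of_tendsto_of_le_of_le hl hu (fun n => ?_) (fun n => ?_)
  · have h : (g n : ℝ) ≤ L.index * F c₀ (n + T) := by exact_mod_cast hlo n
    have := hgpos (n + T)
    simp only [inv_div]
    rw [div_div, div_le_div_iff₀ (by positivity) this]
    nlinarith
  · have h : (L.index : ℝ) * F c₀ (n + T) ≤ g (n + T + T) := by exact_mod_cast hhi (n + T)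
    have := hgpos (n + T)
    simp only
    rw [div_div, div_le_div_iff₀ this (by positivity)]
    nlinarith
end

section
/- Let n ≥ 1 and ν ≥ 1 be natural numbers and let H be a subgroup of (ℤ/nℤ)^ν. Then there exist a ℤ/nℤ-linear automorphism A of (ℤ/nℤ)^ν, a natural number r ≤ ν, and elements α_1, …, α_r ∈ ℤ/nℤ such that the image A(H) is the subgroup of (ℤ/nℤ)^ν generated by the elements α_1·e_1, …, α_r·e_r, where e_1, …, e_ν are the standard unit vectors of (ℤ/nℤ)^ν. -/
/-- Smith normal form over `ℤ/nℤ`. For any subgroup `H` of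
`(ℤ/nℤ)^ν` there are a `ℤ/nℤ`-linear automorphism `A` of `(ℤ/nℤ)^ν`, an `r ≤ ν`
and elements `α₁, …, α_r ∈ ℤ/nℤ` such that `A(H)` is the subgroup generated by
`α₁·e₁, …, α_r·e_r`, where `e₁, …, e_ν` are the standard unit vectors. -/
theorem smith_normal_form_subgroup (n ν : ℕ) (hn : 1 ≤ n) (hν : 1 ≤ ν)
    (H : AddSubgroup (Fin ν → ZMod n)) :
    ∃ (A : (Fin ν → ZMod n) ≃ₗ[ZMod n] (Fin ν → ZMod n)) (r : ℕ) (hr : r ≤ ν)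
      (α : Fin r → ZMod n),
      H.map A.toLinearMap.toAddMonoidHom =
        AddSubgroup.closure
          {v : Fin ν → ZMod n | ∃ i : Fin r, v = α i • (Pi.single (Fin.castLE hr i) 1 : Fin ν → ZMod n)} := by
  have : NeZero n := ⟨by omega⟩
  -- reduction modulo n
  let p : (Fin ν → ℤ) →+ (Fin ν → ZMod n) := (Int.castAddHom (ZMod n)).compLeft (Fin ν)
  have hp : ∀ w i, p w i = (w i : ZMod n) := fun w i => rfl
  have hps : Function.Surjective p := by
    intro v
    refine ⟨fun i => ((v i).val : ℤ), ?_⟩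
    funext i
    simp [hp]
  have hpz : ∀ (z : ℤ) w, p (z • w) = (z : ZMod n) • p w := by
    intro z w
    funext i
    simp [hp]
  let N : Submodule ℤ (Fin ν → ℤ) := AddSubgroup.toIntSubmodule (H.comap p)
  have hN : ∀ w, w ∈ N ↔ p w ∈ H := fun w => Iff.rfl
  obtain ⟨r, o, hr, bO, bN, a, hb⟩ :=
    N.exists_smith_normal_form_of_le (Pi.basisFun ℤ (Fin ν)) ⊤ le_top
  have ho : o = ν := by
    have h1 := Module.finrank_eq_card_basis bO
    simpa using h1.symm
  subst ho
  let c : Fin o → Fin o → ZMod n := fun i => p (bO i)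
  let f : (Fin o → ZMod n) →ₗ[ZMod n] (Fin o → ZMod n) := Fintype.linearCombination (ZMod n) c
  have hf1 : ∀ i, f (Pi.single i 1) = c i := by
    intro i
    simp [f, Fintype.linearCombination_apply_single]
  have hfs : Function.Surjective f := by
    intro v
    obtain ⟨w, rfl⟩ := hps v
    have hw := congrArg (Submodule.subtype ⊤) (bO.sum_repr ⟨w, trivial⟩)
    refine ⟨fun i => ((bO.repr ⟨w, trivial⟩ i : ℤ) : ZMod n), ?_⟩
    rw [map_sum] at hw
    simp only [map_smul, Submodule.subtype_apply] at hw
    conv_rhs => rw [← hw, map_sum]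
    simp only [f, Fintype.linearCombination_apply, hpz, c]
  have hfb : Function.Bijective f := ⟨Finite.injective_iff_surjective.mpr hfs, hfs⟩
  let e := LinearEquiv.ofBijective f hfb
  have he : ∀ x, e x = f x := fun x => rfl
  have hbp : ∀ i, p (bN i) = (a i : ZMod n) • c (Fin.castLE hr i) := by
    intro i
    rw [hb, hpz]
  refine ⟨e.symm, r, hr, fun i => (a i : ZMod n), ?_⟩
  apply le_antisymm
  · rintro _ ⟨h, hh, rfl⟩
    obtain ⟨w, rfl⟩ := hps h
    have hw := congrArg (Submodule.subtype N) (bN.sum_repr (⟨w, (hN w).mpr hh⟩ : N))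
    rw [map_sum] at hw
    simp only [map_smul, Submodule.subtype_apply] at hw
    rw [← hw, map_sum, map_sum]
    refine AddSubgroup.sum_mem _ fun i _ => ?_
    rw [map_zsmul, map_zsmul]
    apply AddSubgroup.zsmul_mem
    apply AddSubgroup.subset_closure
    refine ⟨i, ?_⟩
    change e.symm (p (bN i)) = _
    rw [LinearEquiv.symm_apply_eq, map_smul, he, hf1, hbp]
  · rw [AddSubgroup.closure_le]
    rintro _ ⟨i, rfl⟩
    refine ⟨p (bN i), (bN i).2, ?_⟩
    change e.symm (p (bN i)) = _
    rw [LinearEquiv.symm_apply_eq, map_smul, he, hf1, hbp]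
end

section
/- Let n ≥ 1 and let a be a natural number. Then the limit as N → ∞ of the quotient (card {(i, j) ∈ ℕ² : i + j ≤ N and n ∣ i + a·j}) / (card {(i, j) ∈ ℕ² : i + j ≤ N}) exists and equals 1/n. -/
lemma card_triangle_aux (P : ℕ → ℕ → Prop) [∀ i j, Decidable (P i j)] (N : ℕ) :
    Nat.card {p : ℕ × ℕ | p.1 + p.2 ≤ N ∧ P p.1 p.2} =
      ∑ j ∈ Finset.range (N + 1), Nat.count (fun i => P i j) (N + 1 - j) := by
  have h : {p : ℕ × ℕ | p.1 + p.2 ≤ N ∧ P p.1 p.2} =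
      (((Finset.range (N + 1) ×ˢ Finset.range (N + 1)).filter
        (fun p : ℕ × ℕ => p.1 + p.2 ≤ N ∧ P p.1 p.2) : Finset (ℕ × ℕ)) : Set (ℕ × ℕ)) := by
    ext p
    simp only [Set.mem_setOf_eq, Finset.coe_filter, Finset.mem_product, Finset.mem_range]
    constructor
    · intro h
      exact ⟨⟨by omega, by omega⟩, h⟩
    · exact fun h => h.2
  rw [h, Nat.card_eq_card_toFinset, Finset.toFinset_coe, Finset.card_filter,
    Finset.sum_product_right]
  refine Finset.sum_congr rfl fun j hj => ?_
  rw [← Finset.card_filter, Nat.count_eq_card_filter_range]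
  congr 1
  ext i
  simp only [Finset.mem_filter, Finset.mem_range] at hj ⊢
  constructor
  · rintro ⟨h1, h2, h3⟩
    exact ⟨by omega, h3⟩
  · rintro ⟨h1, h3⟩
    exact ⟨by omega, by omega, h3⟩

lemma count_dvd_bounds (n : ℕ) (hn : 1 ≤ n) (m : ℕ) :
    m ≤ n * Nat.count (fun i => n ∣ i) m ∧ n * Nat.count (fun i => n ∣ i) m < m + n := by
  have key : (fun i => n ∣ i) = (fun i => i ≡ 0 [MOD n]) := by
    ext i; exact (Nat.modEq_zero_iff_dvd).symm
  have h := Nat.count_modEq_card_eq_ceil m hn 0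
  have h2 : Nat.count (fun i => n ∣ i) m = Nat.count (fun i => i ≡ 0 [MOD n]) m := by
    simp only [Nat.modEq_zero_iff_dvd]
  rw [← h2] at h
  generalize Nat.count (fun i => n ∣ i) m = c at h
  have h3 := h.symm
  rw [Int.ceil_eq_iff] at h3
  have hn' : (0 : ℚ) < n := by exact_mod_cast hn
  simp only [Nat.zero_mod, Nat.cast_zero, sub_zero, Int.cast_natCast] at h3
  obtain ⟨h4, h5⟩ := h3
  rw [lt_div_iff₀ hn'] at h4
  rw [div_le_iff₀ hn'] at h5
  constructor
  · have : (m : ℚ) ≤ n * c := by linarith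
    exact_mod_cast this
  · have : (n * c : ℚ) < m + n := by linarith
    exact_mod_cast this

lemma count_shift_bound (n : ℕ) (hn : 1 ≤ n) (c m : ℕ) :
    |(n : ℝ) * (Nat.count (fun i => n ∣ i + c) m : ℝ) - m| ≤ n := by
  have h := Nat.count_add (fun i => n ∣ i) c m
  have h1 := count_dvd_bounds n hn c
  have h2 := count_dvd_bounds n hn (c + m)
  simp only [add_comm c] at h h2
  rw [h, mul_add] at h2
  have a1 : n * Nat.count (fun i => n ∣ i + c) m ≤ m + n := by omega
  have a2 : m ≤ n * Nat.count (fun i => n ∣ i + c) m + n := by omega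
  have b1 : (n : ℝ) * (Nat.count (fun i => n ∣ i + c) m : ℝ) ≤ m + n := by exact_mod_cast a1
  have b2 : (m : ℝ) ≤ n * (Nat.count (fun i => n ∣ i + c) m : ℝ) + n := by exact_mod_cast a2
  rw [abs_le]
  constructor <;> linarith

lemma triangle_sum (N : ℕ) :
    2 * ∑ j ∈ Finset.range (N + 1), (N + 1 - j) = (N + 1) * (N + 2) := by
  have h := Finset.sum_range_reflect (fun k => k + 1) (N + 1)
  have h2 : ∑ j ∈ Finset.range (N + 1), (N + 1 - j) = ∑ k ∈ Finset.range (N + 1), (k + 1) := by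
    rw [← h]
    refine Finset.sum_congr rfl fun j hj => ?_
    rw [Finset.mem_range] at hj
    omega
  rw [h2]
  clear h h2
  induction N with
  | zero => simp
  | succ k ih => rw [Finset.sum_range_succ, mul_add, ih]; ring

/-- For `n ≥ 1` and a natural number `a`, the density of pairs
`(i, j) ∈ ℕ²` with `n ∣ i + a·j` among all pairs with `i + j ≤ N` tends to `1/n`
as `N → ∞`. -/
theorem density_of_invariant_monomials (n : ℕ) (hn : 1 ≤ n) (a : ℕ) :
    Filter.Tendsto
      (fun N : ℕ =>
        (Nat.card {p : ℕ × ℕ | p.1 + p.2 ≤ N ∧ n ∣ p.1 + a * p.2} : ℝ) /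
        (Nat.card {p : ℕ × ℕ | p.1 + p.2 ≤ N} : ℝ))
      Filter.atTop (nhds (1 / (n : ℝ))) := by
  have hn' : (0 : ℝ) < n := by exact_mod_cast hn
  have hlim : Filter.Tendsto (fun N : ℕ => 2 * (1 / ((N : ℝ) + 1))) Filter.atTop (nhds 0) := by
    simpa using (tendsto_one_div_add_atTop_nhds_zero_nat (𝕜 := ℝ)).const_mul 2
  rw [tendsto_iff_dist_tendsto_zero]
  refine squeeze_zero (fun _ => dist_nonneg) (fun N => ?_) hlim
  have hA := card_triangle_aux (fun i j => n ∣ i + a * j) N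
  have hT : Nat.card {p : ℕ × ℕ | p.1 + p.2 ≤ N} =
      ∑ j ∈ Finset.range (N + 1), (N + 1 - j) := by
    have := card_triangle_aux (fun _ _ => True) N
    simpa using this
  have hT2 := triangle_sum N
  rw [← hT] at hT2
  have hdiff : |(n : ℝ) * (Nat.card {p : ℕ × ℕ | p.1 + p.2 ≤ N ∧ n ∣ p.1 + a * p.2} : ℝ) -
      (Nat.card {p : ℕ × ℕ | p.1 + p.2 ≤ N} : ℝ)| ≤ (N + 1) * n := by
    rw [hA, hT, Nat.cast_sum, Nat.cast_sum, Finset.mul_sum, ← Finset.sum_sub_distrib]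
    refine (Finset.abs_sum_le_sum_abs _ _).trans ?_
    refine (Finset.sum_le_sum fun j _ => count_shift_bound n hn (a * j) (N + 1 - j)).trans ?_
    simp
  generalize (Nat.card {p : ℕ × ℕ | p.1 + p.2 ≤ N ∧ n ∣ p.1 + a * p.2}) = A at hdiff ⊢
  generalize (Nat.card {p : ℕ × ℕ | p.1 + p.2 ≤ N}) = T at hdiff hT2 ⊢
  have hT3 : (2 : ℝ) * T = (N + 1) * (N + 2) := by exact_mod_cast hT2
  have hN : (0 : ℝ) ≤ N := Nat.cast_nonneg N
  have hTpos : (0 : ℝ) < T := by nlinarith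
  have e : (A : ℝ) / T - 1 / n = (n * A - T) / (n * T) := by
    field_simp
  rw [Real.dist_eq, e, abs_div, abs_of_pos (mul_pos hn' hTpos), div_le_iff₀ (mul_pos hn' hTpos)]
  refine hdiff.trans ?_
  have : 2 * (1 / ((N : ℝ) + 1)) * (n * T) = n * (N + 2) := by
    have h1 : (N : ℝ) + 1 ≠ 0 := by positivity
    field_simp
    linarith
  rw [this]
  nlinarith
end
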